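/- There exists a 5 × 2 matrix M of homogeneous polynomials in ℂ[x₀,x₁,x₂,x₃], whose first four rows consist of linear forms (degree 1) and whose fifth row consists of quadratic forms (degree 2), such that for every point p ∈ ℂ⁴ ∖ {0} the complex 5 × 2 matrix M(p) obtained by evaluating the entries at p has rank 2. (Such a matrix defines an injection of vector bundles 2𝒪(−1) → 4𝒪 ⊕ 𝒪(1) on P³ whose cokernel is a rank-3 vector bundle E with c₁ = 3, c₂ = 5, c₃ = 7, arising from a curve of degree 5 linked to a line in a complete intersection of type (2,3).) -/

import Mathlib

open MvPolynomial

/-- If `(a + i b) xᵢ = 0` for `i = 0, …, 3` and `b ∑ xᵢ² = 0` with `x ≠ 0`, then `a = b = 0`. -/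
lemma eq_zero_of_diagonal_pencil {x : Fin 4 → ℂ} (hx : x ≠ 0) {a b : ℂ}
    (hlin : ∀ i : Fin 4, (a + (i : ℕ) * b) * x i = 0) (hquad : b * ∑ i, x i ^ 2 = 0) :
    a = 0 ∧ b = 0 := by
  obtain ⟨i, hi⟩ := Function.ne_iff.mp hx
  have ha : a + (i : ℕ) * b = 0 := (mul_eq_zero.mp (hlin i)).resolve_right hi
  have hb : b = 0 := by
    by_contra hb
    have hj : ∀ j, j ≠ i → x j = 0 := fun j hji => by
      refine (mul_eq_zero.mp (hlin j)).resolve_left fun h => hji ?_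
      have hmul : (((j : ℕ) : ℂ) - (i : ℕ)) * b = 0 := by linear_combination h - ha
      have hcast := sub_eq_zero.mp ((mul_eq_zero.mp hmul).resolve_right hb)
      exact Fin.ext (Nat.cast_injective hcast)
    rw [Finset.sum_eq_single i (fun j _ hji => by simp [hj j hji]) (by simp)] at hquad
    exact mul_ne_zero hb (pow_ne_zero 2 hi) hquad
  exact ⟨by simpa [hb] using ha, hb⟩

/-- The matrix with rows `(xᵢ, i xᵢ)` for `i = 0, …, 3` and last row `(0, ∑ xᵢ²)`. -/
noncomputable def diagonalPencilMatrix : Matrix (Fin 5) (Fin 2) (MvPolynomial (Fin 4) ℂ) :=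
  Fin.snoc (α := fun _ => Fin 2 → MvPolynomial (Fin 4) ℂ)
    (fun i : Fin 4 => ![X i, C ((i : ℕ) : ℂ) * X i]) ![0, ∑ i, X i ^ 2]

lemma diagonalPencilMatrix_castSucc (i : Fin 4) :
    diagonalPencilMatrix i.castSucc = ![X i, C ((i : ℕ) : ℂ) * X i] := by
  unfold diagonalPencilMatrix
  rw [Fin.snoc_castSucc]

lemma diagonalPencilMatrix_last :
    diagonalPencilMatrix 4 = ![0, ∑ i, X i ^ 2] := by
  unfold diagonalPencilMatrix
  rw [show (4 : Fin 5) = Fin.last 4 from rfl, Fin.snoc_last]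

/-- There is a `5 × 2` matrix of homogeneous polynomials on `ℂ⁴`, with linear forms
in the first four rows and quadratic forms in the fifth row, whose evaluation at
every nonzero point of `ℂ⁴` has rank `2` (defining an injection of vector bundles
`2𝒪(−1) → 4𝒪 ⊕ 𝒪(1)` on `P³` with rank-3 globally generated cokernel `E`,
`c₁ = 3`, `c₂ = 5`, `c₃ = 7`). -/
theorem exists_five_by_two_matrix_of_full_rank :
    ∃ M : Matrix (Fin 5) (Fin 2) (MvPolynomial (Fin 4) ℂ),
      (∀ i : Fin 5, (i : ℕ) < 4 → ∀ j, (M i j).IsHomogeneous 1) ∧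
      (∀ j, (M 4 j).IsHomogeneous 2) ∧
      (∀ p : Fin 4 → ℂ, p ≠ 0 → (M.map (eval p)).rank = 2) := by
  refine ⟨diagonalPencilMatrix, fun i hi j => ?_, fun j => ?_, fun p hp => ?_⟩
  · obtain ⟨k, rfl⟩ : ∃ k : Fin 4, k.castSucc = i := ⟨⟨i, hi⟩, rfl⟩
    rw [diagonalPencilMatrix_castSucc]
    fin_cases j
    · exact isHomogeneous_X _ _
    · exact isHomogeneous_C_mul_X _ _
  · rw [diagonalPencilMatrix_last]
    fin_cases j
    · exact isHomogeneous_zero _ _ _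
    · exact IsHomogeneous.sum Finset.univ (fun i : Fin 4 => (X i ^ 2 : MvPolynomial (Fin 4) ℂ)) 2
        fun i _ => isHomogeneous_X_pow i 2
  · have hind : LinearIndependent ℂ (diagonalPencilMatrix.map (eval p)).transpose.row := by
      refine Fintype.linearIndependent_iff.mpr fun c h => ?_
      rw [Fin.sum_univ_two] at h
      refine Fin.forall_fin_two.mpr (eq_zero_of_diagonal_pencil hp (fun i => ?_) ?_)
      · have hrow := congrFun h i.castSucc
        simp only [Matrix.row, Pi.add_apply, Pi.smul_apply, Matrix.transpose_apply,
          Matrix.map_apply, diagonalPencilMatrix_castSucc] at hrow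
        simp at hrow
        linear_combination hrow
      · have hrow := congrFun h 4
        simp only [Matrix.row, Pi.add_apply, Pi.smul_apply, Matrix.transpose_apply,
          Matrix.map_apply, diagonalPencilMatrix_last] at hrow
        simpa using hrow
    rw [← Matrix.rank_transpose, hind.rank_matrix, Fintype.card_fin]
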